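/- Let G be a connected simple graph that is K4-ultrahomogeneous, is not isomorphic to the line graph of any simple graph, and admits a family of 4-element vertex subsets, each inducing a complete subgraph K₄, such that any two distinct members share at most one vertex and every edge of G lies in exactly one member. Let H = G □ G be the Cartesian (box) product of G with itself. Then: (a) H is connected; (b) H is not isomorphic to the line graph of any simple graph; (c) H admits a family of 4-element vertex subsets, each inducing K₄, such that any two distinct members share at most one vertex and every edge of H lies in exactly one member; and (d) H is K4-ultrahomogeneous. -/

import Mathlib

/-- A simple graph is `K₄`-ultrahomogeneous if every adjacency-preserving bijection between
two 4-element vertex subsets, each inducing a complete subgraph `K₄`, extends to an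
automorphism of the graph. -/
def IsK4UH {V : Type} (G : SimpleGraph V) : Prop :=
  ∀ s t : Set V, s.ncard = 4 → t.ncard = 4 →
    (∀ x ∈ s, ∀ y ∈ s, x ≠ y → G.Adj x y) →
    (∀ x ∈ t, ∀ y ∈ t, x ≠ y → G.Adj x y) →
    ∀ φ : s ≃ t,
      (∀ x y : s, G.Adj (φ x : V) (φ y : V) ↔ G.Adj (x : V) (y : V)) →
      ∃ g : G ≃g G, ∀ x : s, g (x : V) = (φ x : V)

/-- A simple graph is an edge-disjoint union of copies of `K₄`: it admits a family of
4-element vertex subsets, each inducing `K₄`, any two distinct members sharing at most one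
vertex, with every edge lying in exactly one member. -/
def HasK4Decomposition {V : Type} (G : SimpleGraph V) : Prop :=
  ∃ ℱ : Set (Set V),
    (∀ s ∈ ℱ, s.ncard = 4 ∧ ∀ x ∈ s, ∀ y ∈ s, x ≠ y → G.Adj x y) ∧
    (∀ s ∈ ℱ, ∀ t ∈ ℱ, s ≠ t → (s ∩ t).ncard ≤ 1) ∧
    (∀ x y : V, G.Adj x y → ∃! s, s ∈ ℱ ∧ x ∈ s ∧ y ∈ s)

/-- A simple graph is a line graph if it is isomorphic to the line graph of some simple
graph. -/
def IsLineGraph {V : Type} (G : SimpleGraph V) : Prop :=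
  ∃ (W : Type) (H : SimpleGraph W), Nonempty (G ≃g H.lineGraph)

namespace SimpleGraph

/-- A graph embedding into a line graph exhibits its domain as a line graph. -/
theorem isLineGraph_of_embedding {V W : Type} {G : SimpleGraph V} {H : SimpleGraph W}
    (f : G ↪g H.lineGraph) : IsLineGraph G := by
  have hedge : (fromEdgeSet (Set.range fun v => (f v : Sym2 W))).edgeSet =
      Set.range fun v => (f v : Sym2 W) := by
    rw [edgeSet_fromEdgeSet, sdiff_eq_left, Set.disjoint_left]
    rintro _ ⟨v, rfl⟩
    exact H.not_isDiag_of_mem_edgeSet (f v).2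
  refine ⟨W, fromEdgeSet (Set.range fun v => (f v : Sym2 W)),
    ⟨⟨(Equiv.ofInjective (fun v => (f v : Sym2 W))
      (Subtype.val_injective.comp f.injective)).trans (Equiv.setCongr hedge.symm), ?_⟩⟩⟩
  intro a b
  rw [← f.map_rel_iff]
  have hinj : (f a : Sym2 W) = f b ↔ a = b := by rw [← Subtype.ext_iff, f.injective.eq_iff]
  simp [lineGraph_adj_iff_exists, Subtype.ext_iff, hinj]

/-- `K₄`-ultrahomogeneity in terms of homomorphisms from the complete graph on `Fin 4`. -/
theorem isK4UH_iff {V : Type} {G : SimpleGraph V} :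
    IsK4UH G ↔ ∀ f f' : (⊤ : SimpleGraph (Fin 4)) →g G, ∃ g : G ≃g G, ∀ i, g (f i) = f' i := by
  constructor
  · intro h f f'
    have hcard (k : (⊤ : SimpleGraph (Fin 4)) →g G) : (Set.range k).ncard = 4 := by
      rw [Set.ncard_range_of_injective k.injective_of_top_hom, Nat.card_fin]
    have hadj (k : (⊤ : SimpleGraph (Fin 4)) →g G) :
        ∀ x ∈ Set.range k, ∀ y ∈ Set.range k, x ≠ y → G.Adj x y := by
      rintro _ ⟨i, rfl⟩ _ ⟨j, rfl⟩ hij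
      exact k.map_adj (by rintro rfl; exact hij rfl)
    let e := Equiv.ofInjective f f.injective_of_top_hom
    let e' := Equiv.ofInjective f' f'.injective_of_top_hom
    obtain ⟨g, hg⟩ := h _ _ (hcard f) (hcard f') (hadj f) (hadj f') (e.symm.trans e') (by
      intro x y
      obtain ⟨i, rfl⟩ := e.surjective x
      obtain ⟨j, rfl⟩ := e.surjective y
      by_cases hij : i = j
      · simp [hij]
      · simp only [Equiv.trans_apply, Equiv.symm_apply_apply]
        exact iff_of_true (f'.map_adj hij) (f.map_adj hij))
    refine ⟨g, fun i => ?_⟩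
    simpa [e, e'] using hg (e i)
  · intro h s t hs ht hsadj htadj φ hφ
    have : Finite s := Set.finite_of_ncard_ne_zero (by omega)
    let e : s ≃ Fin 4 := Finite.equivFinOfCardEq hs
    have hne {i j : Fin 4} (hij : i ≠ j) : ((e.symm i : s) : V) ≠ e.symm j := fun hc =>
      hij (e.symm.injective (Subtype.ext hc))
    obtain ⟨g, hg⟩ := h
      ⟨fun i => e.symm i, fun {i j} hij => hsadj _ (e.symm i).2 _ (e.symm j).2 (hne hij)⟩
      ⟨fun i => φ (e.symm i), fun {i j} hij =>
        (hφ _ _).2 (hsadj _ (e.symm i).2 _ (e.symm j).2 (hne hij))⟩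
    refine ⟨g, fun x => ?_⟩
    simpa using hg (e x)

/-- In a graph decomposed into copies of `K₄`, every non-isolated vertex lies in a `K₄`. -/
theorem exists_hom_apply_zero_eq {V : Type} {G : SimpleGraph V} (hdec : HasK4Decomposition G)
    {a b : V} (hab : G.Adj a b) : ∃ f : (⊤ : SimpleGraph (Fin 4)) →g G, f 0 = a := by
  obtain ⟨ℱ, hclique, -, hedge⟩ := hdec
  obtain ⟨s, ⟨hs, ha, -⟩, -⟩ := hedge a b hab
  obtain ⟨hcard, hadj⟩ := hclique s hs
  have : Finite s := Set.finite_of_ncard_ne_zero (by omega)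
  let e₀ : s ≃ Fin 4 := Finite.equivFinOfCardEq hcard
  let e : Fin 4 ≃ s := (e₀.trans (Equiv.swap 0 (e₀ ⟨a, ha⟩))).symm
  refine ⟨⟨fun i => e i, fun {i j} hij => hadj _ (e i).2 _ (e j).2 fun hc =>
    hij (e.injective (Subtype.ext hc))⟩, ?_⟩
  change (e 0 : V) = a
  simp [e]

/-- A connected `K₄`-ultrahomogeneous graph decomposed into copies of `K₄` is
vertex-transitive. -/
theorem exists_iso_apply_eq {V : Type} {G : SimpleGraph V} (hconn : G.Connected)
    (hUH : IsK4UH G) (hdec : HasK4Decomposition G) (a b : V) : ∃ g : G ≃g G, g a = b := by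
  rcases eq_or_ne a b with rfl | hab
  · exact ⟨Iso.refl, rfl⟩
  have : Nontrivial V := ⟨a, b, hab⟩
  obtain ⟨a', ha⟩ := hconn.preconnected.exists_adj_of_nontrivial a
  obtain ⟨b', hb⟩ := hconn.preconnected.exists_adj_of_nontrivial b
  obtain ⟨f, rfl⟩ := exists_hom_apply_zero_eq hdec ha
  obtain ⟨f', rfl⟩ := exists_hom_apply_zero_eq hdec hb
  obtain ⟨g, hg⟩ := isK4UH_iff.1 hUH f f'
  exact ⟨g, hg 0⟩

/-- The box product of two graph isomorphisms. -/
def boxProdCongr {V W V' W' : Type} {G : SimpleGraph V} {H : SimpleGraph W}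
    {G' : SimpleGraph V'} {H' : SimpleGraph W'} (g : G ≃g G') (h : H ≃g H') :
    (G □ H) ≃g (G' □ H') where
  toEquiv := g.toEquiv.prodCongr h.toEquiv
  map_rel_iff' := by simp [boxProd_adj, g.map_adj_iff, h.map_adj_iff]

/-- A clique of `G □ G` on `Fin 4` is, up to an automorphism, contained in a fibre of the second
projection. -/
theorem exists_iso_apply_boxProd_eq {V : Type} {G : SimpleGraph V}
    (f : (⊤ : SimpleGraph (Fin 4)) →g (G □ G)) :
    ∃ (σ : (G □ G) ≃g (G □ G)) (k : (⊤ : SimpleGraph (Fin 4)) →g G) (b : V),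
      ∀ i, f i = σ (k i, b) := by
  have hadj {i j : Fin 4} (hij : i ≠ j) := boxProd_adj.1 (f.map_adj hij)
  have hfib : (∀ i, (f i).2 = (f 0).2) ∨ ∀ i, (f i).1 = (f 0).1 := by
    have hloop (v : V) : ¬ G.Adj v v := G.irrefl
    have h01 := hadj (i := 0) (j := 1) (by decide)
    rcases h01 with h01 | h01
    · left
      intro i
      by_contra hi
      have h0 := hadj (i := 0) (j := i) (by rintro rfl; exact hi rfl)
      have h1 := hadj (i := 1) (j := i) (by rintro rfl; exact hi h01.2.symm)
      grind
    · right
      intro i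
      by_contra hi
      have h0 := hadj (i := 0) (j := i) (by rintro rfl; exact hi rfl)
      have h1 := hadj (i := 1) (j := i) (by rintro rfl; exact hi h01.2.symm)
      grind
  rcases hfib with h | h
  · refine ⟨Iso.refl, ⟨fun i => (f i).1, fun {i j} hij => ?_⟩, (f 0).2, fun i =>
      Prod.ext rfl (h i)⟩
    rcases hadj hij with hA | hA
    · exact hA.1
    · exact (G.irrefl (((h i).trans (h j).symm) ▸ hA.1)).elim
  · refine ⟨boxProdComm G G, ⟨fun i => (f i).2, fun {i j} hij => ?_⟩, (f 0).1, fun i =>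
      Prod.ext (h i) rfl⟩
    rcases hadj hij with hA | hA
    · exact (G.irrefl (((h i).trans (h j).symm) ▸ hA.1)).elim
    · exact hA.1

/-- Ultrahomogeneity of `G □ G` for vertex-transitive `K₄`-ultrahomogeneous `G`. -/
theorem isK4UH_boxProd_self {V : Type} {G : SimpleGraph V} (hUH : IsK4UH G)
    (htrans : ∀ a b : V, ∃ g : G ≃g G, g a = b) : IsK4UH (G □ G) := by
  rw [isK4UH_iff] at hUH ⊢
  intro f f'
  obtain ⟨σ, k, b, hf⟩ := exists_iso_apply_boxProd_eq f
  obtain ⟨σ', k', b', hf'⟩ := exists_iso_apply_boxProd_eq f'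
  obtain ⟨g, hg⟩ := hUH k k'
  obtain ⟨h, hh⟩ := htrans b b'
  refine ⟨(σ.symm.trans (boxProdCongr g h)).trans σ', fun i => ?_⟩
  rw [hf, hf', ← hg, ← hh]
  exact congrArg (fun x => σ' (boxProdCongr g h x)) (σ.symm_apply_apply (k i, b))

/-- The box product of graphs decomposed into copies of `K₄` is decomposed into copies
of `K₄`, namely the copies contained in fibres of the two projections. -/
theorem hasK4Decomposition_boxProd {V W : Type} {G : SimpleGraph V} {H : SimpleGraph W}
    (hG : HasK4Decomposition G) (hH : HasK4Decomposition H) : HasK4Decomposition (G □ H) := by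
  obtain ⟨ℱ, hF, hFint, hFedge⟩ := hG
  obtain ⟨ℋ, hK, hKint, hKedge⟩ := hH
  have hl (b : W) (s : Set V) : (s ×ˢ {b} : Set (V × W)).ncard = s.ncard := by
    simp [Set.ncard_prod]
  have hr (a : V) (s : Set W) : ({a} ×ˢ s : Set (V × W)).ncard = s.ncard := by
    simp [Set.ncard_prod]
  refine ⟨{u | (∃ s ∈ ℱ, ∃ b, u = s ×ˢ {b}) ∨ ∃ a, ∃ s ∈ ℋ, u = {a} ×ˢ s}, ?_, ?_, ?_⟩
  · rintro _ (⟨s, hs, b, rfl⟩ | ⟨a, s, hs, rfl⟩)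
    · refine ⟨(hl b s).trans (hF s hs).1, ?_⟩
      rintro ⟨x, _⟩ ⟨hx, rfl⟩ ⟨y, _⟩ ⟨hy, rfl⟩ hne
      exact boxProd_adj.2 (.inl ⟨(hF s hs).2 x hx y hy (by grind), rfl⟩)
    · refine ⟨(hr a s).trans (hK s hs).1, ?_⟩
      rintro ⟨_, x⟩ ⟨rfl, hx⟩ ⟨_, y⟩ ⟨rfl, hy⟩ hne
      exact boxProd_adj.2 (.inr ⟨(hK s hs).2 x hx y hy (by grind), rfl⟩)
  · rintro _ (⟨s, hs, b, rfl⟩ | ⟨a, s, hs, rfl⟩) _ (⟨t, ht, d, rfl⟩ | ⟨c, t, ht, rfl⟩) hne <;>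
      rw [Set.prod_inter_prod]
    · by_cases hbd : b = d
      · subst hbd
        rw [Set.inter_self, hl]
        exact hFint s hs t ht (by rintro rfl; exact hne rfl)
      · simp [Set.singleton_inter_eq_empty.2 (show b ∉ ({d} : Set W) from hbd)]
    · refine (Set.ncard_le_ncard (t := {(c, b)}) ?_).trans (Set.ncard_singleton _).le
      rintro ⟨x, y⟩ ⟨⟨-, hx⟩, hy, -⟩
      exact Prod.ext hx hy
    · refine (Set.ncard_le_ncard (t := {(a, d)}) ?_).trans (Set.ncard_singleton _).le
      rintro ⟨x, y⟩ ⟨⟨hx, -⟩, -, hy⟩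
      exact Prod.ext hx hy
    · by_cases hac : a = c
      · subst hac
        rw [Set.inter_self, hr]
        exact hKint s hs t ht (by rintro rfl; exact hne rfl)
      · simp [Set.singleton_inter_eq_empty.2 (show a ∉ ({c} : Set V) from hac)]
  · rintro ⟨x, x'⟩ ⟨y, y'⟩ hxy
    rcases boxProd_adj.1 hxy with ⟨hadj, h⟩ | ⟨hadj, h⟩ <;> dsimp only at hadj h <;> subst h
    · obtain ⟨s, ⟨hs, hx, hy⟩, huniq⟩ := hFedge x y hadj
      refine ⟨s ×ˢ {x'}, ⟨.inl ⟨s, hs, x', rfl⟩, ⟨hx, rfl⟩, ⟨hy, rfl⟩⟩, ?_⟩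
      rintro _ ⟨⟨t, ht, b, rfl⟩ | ⟨a, t, ht, rfl⟩, ⟨hx₁, hx₂⟩, ⟨hy₁, hy₂⟩⟩
      · rw [huniq t ⟨ht, hx₁, hy₁⟩, show x' = b from hx₂]
      · exact (hadj.ne ((show x = a from hx₁).trans (show y = a from hy₁).symm)).elim
    · obtain ⟨s, ⟨hs, hx, hy⟩, huniq⟩ := hKedge x' y' hadj
      refine ⟨{x} ×ˢ s, ⟨.inr ⟨x, s, hs, rfl⟩, ⟨rfl, hx⟩, ⟨rfl, hy⟩⟩, ?_⟩
      rintro _ ⟨⟨t, ht, b, rfl⟩ | ⟨a, t, ht, rfl⟩, ⟨hx₁, hx₂⟩, ⟨hy₁, hy₂⟩⟩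
      · exact (hadj.ne ((show x' = b from hx₂).trans (show y' = b from hy₂).symm)).elim
      · rw [huniq t ⟨ht, hx₂, hy₂⟩, show x = a from hx₁]

end SimpleGraph

/-- If `G` is a connected `K₄`-ultrahomogeneous simple graph that is not a line graph and is
an edge-disjoint union of copies of `K₄`, then the Cartesian square `G □ G` is (a) connected,
(b) not a line graph, (c) an edge-disjoint union of copies of `K₄`, and (d)
`K₄`-ultrahomogeneous. -/
theorem cartesianSquare_of_K4UH {V : Type} (G : SimpleGraph V)
    (hconn : G.Connected) (hUH : IsK4UH G) (hnl : ¬ IsLineGraph G)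
    (hdec : HasK4Decomposition G) :
    (G □ G).Connected ∧
    ¬ IsLineGraph (G □ G) ∧
    HasK4Decomposition (G □ G) ∧
    IsK4UH (G □ G) := by
  refine ⟨hconn.boxProd hconn, ?_, SimpleGraph.hasK4Decomposition_boxProd hdec hdec,
    SimpleGraph.isK4UH_boxProd_self hUH (SimpleGraph.exists_iso_apply_eq hconn hUH hdec)⟩
  rintro ⟨W, H, ⟨e⟩⟩
  obtain ⟨v⟩ := hconn.nonempty
  exact hnl (SimpleGraph.isLineGraph_of_embedding ((G.boxProdLeft G v).trans e.toEmbedding))
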